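/- arXiv:2601.10750 — 2 statements merged into one kernel-verified Lean document; each statement's English description precedes it below -/
import Mathlib

section
/- There exists a constant c ≥ 1 such that for every k ≥ 0 there exist functions ψ₀, ψ₁, ψ₂, ψ₃ : V_k → ℝ with: (a) 0 ≤ ψ_i ≤ 1 for each i and ψ₀ + ψ₁ + ψ₂ + ψ₃ ≡ 1 on V_k; (b) writing p₀ = (0,0), p₁ = (1,0), p₂ = (1,1), p₃ = (0,1), one has ψ_i(p_i) = 1 and ψ_i ≡ 0 on V_k ∩ e for each of the two closed edges e of the square [0,1]² that do not contain the corner p_i; (c) D_k(ψ_i) ≤ c·𝓡̄_k⁻¹ for each i. (Existence of pre-extension kernels, the partition-of-unity step in the proof of Proposition 3.4 of the paper, in the planar case.) -/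
open Finset
open scoped Classical

namespace Carpet

/-- The contraction map `Ψ_{(a,b)}(x,y) = ((x+a)/L, (y+b)/L)`. -/
noncomputable def Psi (L : ℕ) (p : ℕ × ℕ) (x : ℝ × ℝ) : ℝ × ℝ :=
  ((x.1 + p.1) / L, (x.2 + p.2) / L)

/-- Words of length `n` over the alphabet `A`. -/
abbrev Word (A : Finset (ℕ × ℕ)) (n : ℕ) := Fin n → {p : ℕ × ℕ // p ∈ A}

/-- `Ψ_w = Ψ_{w₁} ∘ ⋯ ∘ Ψ_{w_n}`. -/
noncomputable def PsiW (L : ℕ) {A : Finset (ℕ × ℕ)} {n : ℕ} (w : Word A n) : ℝ × ℝ → ℝ × ℝ :=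
  (List.ofFn fun i => Psi L (w i).1).foldr (· ∘ ·) id

/-- The four corners of the unit square. -/
noncomputable def V0 : Finset (ℝ × ℝ) :=
  {((0 : ℝ), (0 : ℝ)), ((1 : ℝ), (0 : ℝ)), ((1 : ℝ), (1 : ℝ)), ((0 : ℝ), (1 : ℝ))}

/-- The level-`n` vertex set `V_n = ⋃_{w ∈ W_n} Ψ_w(V₀)`. -/
noncomputable def VN (L : ℕ) (A : Finset (ℕ × ℕ)) (n : ℕ) : Finset (ℝ × ℝ) :=
  (Finset.univ : Finset (Word A n)).biUnion fun w => V0.image (PsiW L w)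

/-- Euclidean distance in the plane. -/
noncomputable def eudist (x y : ℝ × ℝ) : ℝ :=
  Real.sqrt ((x.1 - y.1) ^ 2 + (x.2 - y.2) ^ 2)

/-- `n`-adjacency: `x = Ψ_w(p)`, `y = Ψ_w(q)` with `p, q ∈ V₀`, `|p - q| = 1`. -/
def Adj (L : ℕ) (A : Finset (ℕ × ℕ)) (n : ℕ) (x y : ℝ × ℝ) : Prop :=
  ∃ w : Word A n, ∃ p ∈ V0, ∃ q ∈ V0,
    eudist p q = 1 ∧ x = PsiW L w p ∧ y = PsiW L w q

/-- The natural graph energy `D_n(f) = Σ_{x ∼ y} (f x - f y)²`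
(summing over ordered pairs and halving). -/
noncomputable def Dform (L : ℕ) (A : Finset (ℕ × ℕ)) (n : ℕ) (f : ℝ × ℝ → ℝ) : ℝ :=
  (1 / 2) * ∑ x ∈ VN L A n, ∑ y ∈ VN L A n,
    (if Adj L A n x y then (f x - f y) ^ 2 else 0)

/-- The effective resistance between `S` and `T` in the level-`n` graph. -/
noncomputable def EffRes (L : ℕ) (A : Finset (ℕ × ℕ)) (n : ℕ) (S T : Set (ℝ × ℝ)) : ℝ :=
  (sInf {e : ℝ | ∃ f : ℝ × ℝ → ℝ,
      (∀ x ∈ S, f x = 1) ∧ (∀ x ∈ T, f x = 0) ∧ e = Dform L A n f})⁻¹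

/-- `𝓡_n`, the resistance between the corners `(0,0)` and `(1,0)`. -/
noncomputable def RR (L : ℕ) (A : Finset (ℕ × ℕ)) (n : ℕ) : ℝ :=
  EffRes L A n {((0 : ℝ), (0 : ℝ))} {((1 : ℝ), (0 : ℝ))}

/-- `𝓡̄_n`, the resistance between the left and right sides of the unit square. -/
noncomputable def RRbar (L : ℕ) (A : Finset (ℕ × ℕ)) (n : ℕ) : ℝ :=
  EffRes L A n
    ((VN L A n : Set (ℝ × ℝ)) ∩ ({(0 : ℝ)} ×ˢ Set.Icc (0 : ℝ) 1))
    ((VN L A n : Set (ℝ × ℝ)) ∩ ({(1 : ℝ)} ×ˢ Set.Icc (0 : ℝ) 1))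

/-- The standing assumptions on `(L, A)` defining a generalized Sierpiński carpet. -/
structure GoodCarpet (L : ℕ) (A : Finset (ℕ × ℕ)) : Prop where
  three_le : 3 ≤ L
  mem_lt : ∀ p ∈ A, p.1 < L ∧ p.2 < L
  symm_swap : ∀ a b : ℕ, (a, b) ∈ A → (b, a) ∈ A
  symm_reflect : ∀ a b : ℕ, (a, b) ∈ A → (L - 1 - a, b) ∈ A
  connected : IsConnected
    (⋃ p ∈ A, Set.Icc (((p.1 : ℝ) / L, (p.2 : ℝ) / L) : ℝ × ℝ)
      ((((p.1 : ℝ) + 1) / L, ((p.2 : ℝ) + 1) / L) : ℝ × ℝ))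
  flat_border : ∀ a b : ℕ, a < L → b < L →
    (a = 0 ∨ a = L - 1 ∨ b = 0 ∨ b = L - 1) → (a, b) ∈ A
  proper : ∃ a b : ℕ, a < L ∧ b < L ∧ (a, b) ∉ A

/-- The generalized Sierpiński carpet `F`. -/
def carpetF (L : ℕ) (A : Finset (ℕ × ℕ)) : Set (ℝ × ℝ) :=
  ⋂ n : ℕ, ⋃ w : Word A n, PsiW L w '' Set.Icc (((0 : ℝ), (0 : ℝ)) : ℝ × ℝ) ((1 : ℝ), (1 : ℝ))


/-- The four corners of the unit square, indexed. -/
noncomputable def corner : Fin 4 → ℝ × ℝ :=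
  ![((0 : ℝ), (0 : ℝ)), ((1 : ℝ), (0 : ℝ)), ((1 : ℝ), (1 : ℝ)), ((0 : ℝ), (1 : ℝ))]

/-- The four closed edges of the unit square `[0,1]²`. -/
def squareEdges : Set (Set (ℝ × ℝ)) :=
  { ({(0 : ℝ)} ×ˢ Set.Icc (0 : ℝ) 1), ({(1 : ℝ)} ×ˢ Set.Icc (0 : ℝ) 1),
    (Set.Icc (0 : ℝ) 1 ×ˢ {(0 : ℝ)}), (Set.Icc (0 : ℝ) 1 ×ˢ {(1 : ℝ)}) }

theorem PsiW_zero (L : ℕ) {A : Finset (ℕ × ℕ)} (w : Word A 0) (x : ℝ × ℝ) :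
    PsiW L w x = x := by
  simp [PsiW]

theorem PsiW_succ (L : ℕ) {A : Finset (ℕ × ℕ)} {n : ℕ} (w : Word A (n + 1)) (x : ℝ × ℝ) :
    PsiW L w x = Psi L (w 0).1 (PsiW L (fun i => w i.succ) x) := by
  simp [PsiW, List.ofFn_succ]

/-- The word with both coordinates of each letter exchanged. -/
def swapW {L : ℕ} {A : Finset (ℕ × ℕ)} (h : GoodCarpet L A) {n : ℕ} (w : Word A n) : Word A n :=
  fun i => ⟨(w i).1.swap, h.symm_swap _ _ (w i).2⟩

theorem PsiW_swap {L : ℕ} {A : Finset (ℕ × ℕ)} (h : GoodCarpet L A) {n : ℕ} (w : Word A n)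
    (x : ℝ × ℝ) : PsiW L (swapW h w) x.swap = (PsiW L w x).swap := by
  induction n with
  | zero => simp [PsiW_zero]
  | succ n ih =>
    rw [PsiW_succ, PsiW_succ]
    have := ih (fun i => w i.succ)
    change Psi L (w 0).1.swap (PsiW L (swapW h fun i => w i.succ) x.swap) = _
    rw [this]
    simp [Psi]

theorem V0_swap {x : ℝ × ℝ} (hx : x ∈ V0) : x.swap ∈ V0 := by
  simp only [V0, Finset.mem_insert, Finset.mem_singleton] at hx ⊢
  rcases hx with rfl | rfl | rfl | rfl <;> simp

theorem VN_swap {L : ℕ} {A : Finset (ℕ × ℕ)} (h : GoodCarpet L A) {n : ℕ} {x : ℝ × ℝ}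
    (hx : x ∈ VN L A n) : x.swap ∈ VN L A n := by
  simp only [VN, Finset.mem_biUnion, Finset.mem_univ, true_and, Finset.mem_image] at hx ⊢
  obtain ⟨w, p, hp, rfl⟩ := hx
  exact ⟨swapW h w, p.swap, V0_swap hp, PsiW_swap h w p⟩

theorem Adj_swap {L : ℕ} {A : Finset (ℕ × ℕ)} (h : GoodCarpet L A) {n : ℕ} {x y : ℝ × ℝ}
    (hx : Adj L A n x y) : Adj L A n x.swap y.swap := by
  obtain ⟨w, p, hp, q, hq, hd, rfl, rfl⟩ := hx
  refine ⟨swapW h w, p.swap, V0_swap hp, q.swap, V0_swap hq, ?_,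
    (PsiW_swap h w p).symm, (PsiW_swap h w q).symm⟩
  rw [← hd]
  simp [eudist, add_comm]

theorem Dform_swap {L : ℕ} {A : Finset (ℕ × ℕ)} (h : GoodCarpet L A) (n : ℕ) (f : ℝ × ℝ → ℝ) :
    Dform L A n (fun x => f x.swap) = Dform L A n f := by
  have key : ∀ g : ℝ × ℝ → ℝ, ∑ x ∈ VN L A n, g x.swap = ∑ x ∈ VN L A n, g x := fun g =>
    Finset.sum_nbij' Prod.swap Prod.swap (fun _ hx => VN_swap h hx) (fun _ hx => VN_swap h hx)
      (fun _ _ => Prod.swap_swap _) (fun _ _ => Prod.swap_swap _) (fun _ _ => rfl)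
  have hA : ∀ x y, Adj L A n x y ↔ Adj L A n x.swap y.swap := fun x y =>
    ⟨Adj_swap h, fun hh => by simpa using Adj_swap h hh⟩
  unfold Dform
  congr 1
  rw [← key fun x => ∑ y ∈ VN L A n, if Adj L A n x y then (f x - f y) ^ 2 else 0]
  refine Finset.sum_congr rfl fun x _ => ?_
  rw [← key fun y => if Adj L A n x.swap y then (f x.swap - f y) ^ 2 else 0]
  refine Finset.sum_congr rfl fun y _ => ?_
  simp only [hA x y]

theorem PsiW_mem {L : ℕ} {A : Finset (ℕ × ℕ)} (h : GoodCarpet L A) {n : ℕ} (w : Word A n)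
    (x : ℝ × ℝ) (h1 : x.2 ∈ Set.Icc (0 : ℝ) 1) : (PsiW L w x).2 ∈ Set.Icc (0 : ℝ) 1 := by
  induction n with
  | zero => simpa [PsiW_zero] using h1
  | succ n ih =>
    rw [PsiW_succ]
    obtain ⟨a, b⟩ := ih (fun i => w i.succ)
    have hL : (0 : ℝ) < L := by
      have := h.three_le
      exact_mod_cast (by omega : 0 < L)
    have hlt : (((w 0).1.2 : ℕ) : ℝ) + 1 ≤ L := by
      exact_mod_cast (h.mem_lt _ (w 0).2).2
    have h0 : (0 : ℝ) ≤ (((w 0).1.2 : ℕ) : ℝ) := Nat.cast_nonneg _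
    constructor
    · simp only [Psi]; positivity
    · simp only [Psi]
      rw [div_le_one hL]; linarith

theorem VN_mem {L : ℕ} {A : Finset (ℕ × ℕ)} (h : GoodCarpet L A) {n : ℕ} {x : ℝ × ℝ}
    (hx : x ∈ VN L A n) : x.2 ∈ Set.Icc (0 : ℝ) 1 := by
  simp only [VN, Finset.mem_biUnion, Finset.mem_univ, true_and, Finset.mem_image] at hx
  obtain ⟨w, p, hp, rfl⟩ := hx
  apply PsiW_mem h
  simp only [V0, Finset.mem_insert, Finset.mem_singleton] at hp
  rcases hp with rfl | rfl | rfl | rfl <;> simp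

theorem Dform_mono {L : ℕ} {A : Finset (ℕ × ℕ)} {n : ℕ} {f g : ℝ × ℝ → ℝ}
    (hfg : ∀ x ∈ VN L A n, ∀ y ∈ VN L A n, (f x - f y) ^ 2 ≤ (g x - g y) ^ 2) :
    Dform L A n f ≤ Dform L A n g := by
  unfold Dform
  refine mul_le_mul_of_nonneg_left ?_ (by norm_num)
  refine Finset.sum_le_sum fun x hx => Finset.sum_le_sum fun y hy => ?_
  split_ifs
  · exact hfg x hx y hy
  · exact le_rfl

theorem Dform_le_two {L : ℕ} {A : Finset (ℕ × ℕ)} {n : ℕ} {f u v : ℝ × ℝ → ℝ}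
    (hfg : ∀ x y, (f x - f y) ^ 2 ≤ 2 * (u x - u y) ^ 2 + 2 * (v x - v y) ^ 2) :
    Dform L A n f ≤ 2 * Dform L A n u + 2 * Dform L A n v := by
  have e : 2 * Dform L A n u + 2 * Dform L A n v = (1 / 2) * ∑ x ∈ VN L A n, ∑ y ∈ VN L A n,
      (2 * (if Adj L A n x y then (u x - u y) ^ 2 else 0) +
        2 * (if Adj L A n x y then (v x - v y) ^ 2 else 0)) := by
    simp only [Dform, Finset.sum_add_distrib, ← Finset.mul_sum]
    ring
  rw [e]
  unfold Dform
  refine mul_le_mul_of_nonneg_left ?_ (by norm_num)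
  refine Finset.sum_le_sum fun x _ => Finset.sum_le_sum fun y _ => ?_
  split_ifs
  · exact hfg x y
  · simp

theorem prod_sq {a b a' b' : ℝ} (ha : 0 ≤ a ∧ a ≤ 1) (hb : 0 ≤ b' ∧ b' ≤ 1) :
    (a * b - a' * b') ^ 2 ≤ 2 * (a - a') ^ 2 + 2 * (b - b') ^ 2 := by
  have h1 : a ^ 2 ≤ 1 := by nlinarith
  have h2 : b' ^ 2 ≤ 1 := by nlinarith
  have e : a * b - a' * b' = a * (b - b') + b' * (a - a') := by ring
  rw [e]
  nlinarith [sq_nonneg (a * (b - b') - b' * (a - a')),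
    mul_nonneg (sub_nonneg.2 h1) (sq_nonneg (b - b')),
    mul_nonneg (sub_nonneg.2 h2) (sq_nonneg (a - a'))]

theorem clip_sq (a b : ℝ) :
    (max 0 (min 1 a) - max 0 (min 1 b)) ^ 2 ≤ (a - b) ^ 2 := by
  apply sq_le_sq.2
  exact (abs_max_sub_max_le_max _ _ _ _).trans
    (by simpa using (abs_min_sub_min_le_max 1 a 1 b))

theorem Dform_continuous (L : ℕ) (A : Finset (ℕ × ℕ)) (n : ℕ) :
    Continuous (Dform L A n) := by
  unfold Dform
  refine continuous_const.mul ?_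
  refine continuous_finsetSum _ fun x _ => continuous_finsetSum _ fun y _ => ?_
  split_ifs
  · exact ((continuous_apply x).sub (continuous_apply y)).pow 2
  · exact continuous_const

theorem exists_potential {L : ℕ} {A : Finset (ℕ × ℕ)} (h : GoodCarpet L A) (n : ℕ) :
    ∃ u : ℝ × ℝ → ℝ, (∀ x, 0 ≤ u x ∧ u x ≤ 1) ∧ (∀ x, x.1 = 0 → u x = 1) ∧
      (∀ x, x.1 = 1 → u x = 0) ∧ Dform L A n u ≤ (RRbar L A n)⁻¹ := by
  let C : ℝ × ℝ → Set ℝ := fun x => if x.1 = 0 then {1} else if x.1 = 1 then {0} else Set.Icc 0 1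
  have hC : ∀ x, IsCompact (C x) := by
    intro x
    simp only [C]
    split_ifs
    · exact isCompact_singleton
    · exact isCompact_singleton
    · exact isCompact_Icc
  have hK : IsCompact (Set.univ.pi C) := isCompact_univ_pi hC
  let cl : (ℝ × ℝ → ℝ) → (ℝ × ℝ → ℝ) := fun f x =>
    if x.1 = 0 then 1 else if x.1 = 1 then 0 else max 0 (min 1 (f x))
  have hcl : ∀ f, cl f ∈ Set.univ.pi C := by
    intro f x _
    simp only [cl, C]
    split_ifs <;> simp
  obtain ⟨u, huK, hu⟩ := hK.exists_isMinOn ⟨_, hcl 0⟩ (Dform_continuous L A n).continuousOn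
  have huC : ∀ x, u x ∈ C x := fun x => huK x (Set.mem_univ x)
  refine ⟨u, fun x => ?_, fun x hx => ?_, fun x hx => ?_, ?_⟩
  · have := huC x
    simp only [C] at this
    split_ifs at this
    · rw [Set.mem_singleton_iff.1 this]; norm_num
    · rw [Set.mem_singleton_iff.1 this]; norm_num
    · exact this
  · simpa [C, hx] using huC x
  · simpa [C, hx] using huC x
  · unfold RRbar EffRes
    rw [inv_inv]
    refine le_csInf ⟨_, cl 0, ?_, ?_, rfl⟩ ?_
    · rintro x ⟨_, hx, _⟩
      have hx : x.1 = 0 := hx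
      simp [cl, hx]
    · rintro x ⟨_, hx, _⟩
      have hx : x.1 = 1 := hx
      simp [cl, hx]
    · rintro e ⟨f, hS, hT, rfl⟩
      refine (hu (hcl f)).trans (Dform_mono ?_)
      have hc : ∀ x ∈ VN L A n, cl f x = max 0 (min 1 (f x)) := by
        intro x hx
        simp only [cl]
        split_ifs with h0 h1
        · rw [hS x ⟨hx, h0, VN_mem h hx⟩]; simp
        · rw [hT x ⟨hx, h1, VN_mem h hx⟩]; simp
        · rfl
      intro x hx y hy
      rw [hc x hx, hc y hy]
      exact clip_sq _ _

/-- partition-of-unity step in the proof of Proposition 3.4,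
planar case: existence of pre-extension kernels. -/
theorem pre_extension_kernels (L : ℕ) (A : Finset (ℕ × ℕ)) (h : GoodCarpet L A) :
    ∃ c : ℝ, 1 ≤ c ∧ ∀ k : ℕ, ∃ ψ : Fin 4 → (ℝ × ℝ → ℝ),
      -- (a) values in [0,1] and partition of unity on V_k
      (∀ i : Fin 4, ∀ x ∈ VN L A k, 0 ≤ ψ i x ∧ ψ i x ≤ 1) ∧
      (∀ x ∈ VN L A k, ψ 0 x + ψ 1 x + ψ 2 x + ψ 3 x = 1) ∧
      -- (b) boundary conditions
      (∀ i : Fin 4, ψ i (corner i) = 1) ∧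
      (∀ i : Fin 4, ∀ e ∈ squareEdges, corner i ∉ e →
        ∀ x ∈ (VN L A k : Set (ℝ × ℝ)) ∩ e, ψ i x = 0) ∧
      -- (c) energy estimate
      (∀ i : Fin 4, Dform L A k (ψ i) ≤ c * (RRbar L A k)⁻¹) := by
  refine ⟨4, by norm_num, fun k => ?_⟩
  obtain ⟨u, hu, hu0, hu1, hD⟩ := exists_potential h k
  have hDs : Dform L A k (fun x => u x.swap) ≤ (RRbar L A k)⁻¹ := (Dform_swap h k u).trans_le hD
  have en : ∀ f : ℝ × ℝ → ℝ, (∀ x y, (f x - f y) ^ 2 ≤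
      2 * (u x - u y) ^ 2 + 2 * (u x.swap - u y.swap) ^ 2) →
      Dform L A k f ≤ 4 * (RRbar L A k)⁻¹ := by
    intro f hf
    have := Dform_le_two (L := L) (A := A) (n := k) (v := fun x => u x.swap) hf
    linarith
  have hu' : ∀ x, 0 ≤ 1 - u x ∧ 1 - u x ≤ 1 := fun x =>
    ⟨by linarith [(hu x).2], by linarith [(hu x).1]⟩
  have pr : ∀ a b : ℝ, (0 ≤ a ∧ a ≤ 1) → (0 ≤ b ∧ b ≤ 1) → 0 ≤ a * b ∧ a * b ≤ 1 :=
    fun a b ha hb => ⟨mul_nonneg ha.1 hb.1, mul_le_one₀ ha.2 hb.1 hb.2⟩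
  refine ⟨![fun x => u x * u x.swap, fun x => (1 - u x) * u x.swap,
    fun x => (1 - u x) * (1 - u x.swap), fun x => u x * (1 - u x.swap)], ?_, ?_, ?_, ?_, ?_⟩
  · intro i x _
    fin_cases i
    · exact pr _ _ (hu _) (hu _)
    · exact pr _ _ (hu' _) (hu _)
    · exact pr _ _ (hu' _) (hu' _)
    · exact pr _ _ (hu _) (hu' _)
  · intro x _
    simp
    ring
  · intro i
    fin_cases i <;> simp [corner, hu0, hu1]
  · rintro i e he hi ⟨a, b⟩ ⟨_, hx⟩
    simp only [squareEdges, Set.mem_insert_iff, Set.mem_singleton_iff] at he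
    rcases he with rfl | rfl | rfl | rfl <;> fin_cases i <;>
      simp [corner] at hi hx ⊢ <;> simp [hx, hu0, hu1]
  · intro i
    fin_cases i
    · exact en _ fun x y => prod_sq (hu _) (hu _)
    · refine en _ fun x y => (prod_sq (hu' _) (hu _)).trans_eq (by ring)
    · refine en _ fun x y => (prod_sq (hu' _) (hu' _)).trans_eq (by ring)
    · refine en _ fun x y => (prod_sq (hu _) (hu' _)).trans_eq (by ring)


end Carpet
end

section
/- There exists a constant c ≥ 1 such that c⁻¹·𝓡_n ≤ 𝓡_{n+1} ≤ c·𝓡_n for all n ≥ 0. (Two-sided doubling property of the resistance sequence; equation (3.12) of the paper in the planar case.) -/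
open Finset
open scoped Classical

namespace Carpet

/-! ### Words -/

lemma PsiW_succ_left {L : ℕ} {A : Finset (ℕ × ℕ)} {n : ℕ} (w : Word A (n + 1)) (x : ℝ × ℝ) :
    PsiW L w x = Psi L (w 0).1 (PsiW L (fun i : Fin n => w i.succ) x) := by
  simp [PsiW, List.ofFn_succ]

lemma foldr_comp_aux (l : List (ℝ × ℝ → ℝ × ℝ)) (g : ℝ × ℝ → ℝ × ℝ) (x : ℝ × ℝ) :
    l.foldr (· ∘ ·) g x = l.foldr (· ∘ ·) id (g x) := by
  induction l with
  | nil => rfl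
  | cons a l ih => simp only [List.foldr_cons, Function.comp_apply, ih]

lemma PsiW_succ_right {L : ℕ} {A : Finset (ℕ × ℕ)} {n : ℕ} (w : Word A (n + 1)) (x : ℝ × ℝ) :
    PsiW L w x = PsiW L (fun i : Fin n => w i.castSucc) (Psi L (w (Fin.last n)).1 x) := by
  unfold PsiW
  rw [List.ofFn_succ', List.concat_eq_append, List.foldr_append, foldr_comp_aux]
  rfl

/-- Integer coordinates of the lower left corner of a cell. -/
lemma exists_code {L : ℕ} {A : Finset (ℕ × ℕ)} (h : GoodCarpet L A) (n : ℕ) :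
    ∃ a b : Word A n → ℕ, (∀ w w', a w = a w' → b w = b w' → w = w') ∧
      ∀ w x, PsiW L w x = ((x.1 + a w) / (L : ℝ) ^ n, (x.2 + b w) / (L : ℝ) ^ n) := by
  have hL : (L : ℝ) ≠ 0 := by have := h.three_le; positivity
  induction n with
  | zero =>
    refine ⟨fun _ => 0, fun _ => 0, fun w w' _ _ => Subsingleton.elim _ _, fun w x => ?_⟩
    simp [PsiW]
  | succ n ih =>
    obtain ⟨a, b, hinj, hab⟩ := ih
    refine ⟨fun w => (w (Fin.last n)).1.1 + L * a (fun i => w i.castSucc),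
      fun w => (w (Fin.last n)).1.2 + L * b (fun i => w i.castSucc), ?_, ?_⟩
    · intro w w' h1 h2
      have l1 := h.mem_lt _ (w (Fin.last n)).2
      have l2 := h.mem_lt _ (w' (Fin.last n)).2
      have key : ∀ c d e f : ℕ, c < L → d < L → c + L * e = d + L * f → c = d ∧ e = f := by
        intro c d e f hc hd hh
        have hm := congrArg (· % L) hh
        simp only [Nat.add_mul_mod_self_left, Nat.mod_eq_of_lt hc, Nat.mod_eq_of_lt hd] at hm
        subst hm
        refine ⟨rfl, Nat.eq_of_mul_eq_mul_left (by omega : 0 < L) (by omega)⟩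
      obtain ⟨c1, e1⟩ := key _ _ _ _ l1.1 l2.1 h1
      obtain ⟨c2, e2⟩ := key _ _ _ _ l1.2 l2.2 h2
      have hi := hinj _ _ e1 e2
      have hl : w (Fin.last n) = w' (Fin.last n) := Subtype.ext (Prod.ext c1 c2)
      funext i
      refine Fin.lastCases hl (fun j => congrFun hi j) i
    · intro w x
      rw [PsiW_succ_right, hab]
      simp only [Psi]
      push_cast
      ext <;> simp only <;> field_simp <;> ring

/-! ### Energies as sums over edges of cells -/

/-- Oriented edges of the unit square. -/
noncomputable def Eg : Finset ((ℝ × ℝ) × (ℝ × ℝ)) :=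
  (V0 ×ˢ V0).filter fun e => eudist e.1 e.2 = 1

/-- Oriented edges of the level-n graph. -/
noncomputable def PN (L : ℕ) (A : Finset (ℕ × ℕ)) (n : ℕ) : Finset ((ℝ × ℝ) × (ℝ × ℝ)) :=
  (VN L A n ×ˢ VN L A n).filter fun e => Adj L A n e.1 e.2

lemma Dform_eq (L : ℕ) (A : Finset (ℕ × ℕ)) (n : ℕ) (f : ℝ × ℝ → ℝ) :
    Dform L A n f = (1 / 2) * ∑ e ∈ PN L A n, (f e.1 - f e.2) ^ 2 := by
  rw [Dform, PN, Finset.sum_filter, Finset.sum_product]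

lemma Dform_nonneg (L : ℕ) (A : Finset (ℕ × ℕ)) (n : ℕ) (f : ℝ × ℝ → ℝ) :
    0 ≤ Dform L A n f := by
  rw [Dform_eq]; positivity

lemma mem_VN {L : ℕ} {A : Finset (ℕ × ℕ)} {n : ℕ} {x : ℝ × ℝ} :
    x ∈ VN L A n ↔ ∃ w : Word A n, ∃ p ∈ V0, PsiW L w p = x := by
  simp [VN]

lemma mem_PN {L : ℕ} {A : Finset (ℕ × ℕ)} {n : ℕ} {e : (ℝ × ℝ) × (ℝ × ℝ)} :
    e ∈ PN L A n ↔ ∃ w : Word A n, ∃ d ∈ Eg, e = (PsiW L w d.1, PsiW L w d.2) := by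
  unfold PN Eg
  simp only [Finset.mem_filter, Finset.mem_product, mem_VN]
  constructor
  · rintro ⟨-, w, p, hp, q, hq, hd, h1, h2⟩
    exact ⟨w, (p, q), ⟨⟨hp, hq⟩, hd⟩, Prod.ext h1 h2⟩
  · rintro ⟨w, d, ⟨⟨hp, hq⟩, hd⟩, rfl⟩
    exact ⟨⟨⟨w, _, hp, rfl⟩, ⟨w, _, hq, rfl⟩⟩, w, _, hp, _, hq, hd, rfl, rfl⟩

/-- Energy of a single cell. -/
noncomputable def QC (L : ℕ) {A : Finset (ℕ × ℕ)} {n : ℕ} (f : ℝ × ℝ → ℝ) (w : Word A n) : ℝ :=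
  ∑ d ∈ Eg, (f (PsiW L w d.1) - f (PsiW L w d.2)) ^ 2

lemma Dform_le_cells (L : ℕ) (A : Finset (ℕ × ℕ)) (n : ℕ) (f : ℝ × ℝ → ℝ) :
    Dform L A n f ≤ (1 / 2) * ∑ w : Word A n, QC L f w := by
  rw [Dform_eq]
  gcongr
  have hsub : PN L A n = ((Finset.univ : Finset (Word A n)) ×ˢ Eg).image
      fun z => (PsiW L z.1 z.2.1, PsiW L z.1 z.2.2) := by
    ext e
    rw [mem_PN]
    simp only [Finset.mem_image, Finset.mem_product, Finset.mem_univ, true_and]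
    constructor
    · rintro ⟨w, d, hd, rfl⟩
      exact ⟨(w, d), hd, rfl⟩
    · rintro ⟨z, hd, rfl⟩
      exact ⟨z.1, z.2, hd, rfl⟩
  rw [hsub]
  refine (Finset.sum_image_le_of_nonneg fun _ _ => sq_nonneg _).trans ?_
  rw [Finset.sum_product]
  rfl

lemma cells_le_Dform {L : ℕ} {A : Finset (ℕ × ℕ)} (h : GoodCarpet L A) (n : ℕ)
    (f : ℝ × ℝ → ℝ) :
    ∑ w : Word A n, QC L f w ≤ (Eg.card : ℝ) * (2 * Dform L A n f) := by
  obtain ⟨a, b, hinj, hab⟩ := exists_code h n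
  have hL : (L : ℝ) ≠ 0 := by have := h.three_le; positivity
  unfold QC
  rw [Finset.sum_comm, ← nsmul_eq_mul]
  refine Finset.sum_le_card_nsmul _ _ _ fun d hd => ?_
  rw [Dform_eq]
  have hi : Function.Injective fun w : Word A n => (PsiW L w d.1, PsiW L w d.2) := by
    intro w w' hw
    have h1 := congrArg Prod.fst hw
    simp only [hab, Prod.mk.injEq] at h1
    have hLn : (L : ℝ) ^ n ≠ 0 := pow_ne_zero _ hL
    obtain ⟨h2, h3⟩ := h1
    rw [div_left_inj' hLn] at h2 h3
    exact hinj _ _ (by exact_mod_cast add_left_cancel h2) (by exact_mod_cast add_left_cancel h3)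
  have h1 : ∑ w : Word A n, (f (PsiW L w d.1) - f (PsiW L w d.2)) ^ 2
      = ∑ e ∈ (Finset.univ : Finset (Word A n)).image
          (fun w : Word A n => (PsiW L w d.1, PsiW L w d.2)), (f e.1 - f e.2) ^ 2 := by
    rw [Finset.sum_image fun _ _ _ _ hh => hi hh]
  rw [h1, ← mul_assoc]
  norm_num
  refine Finset.sum_le_sum_of_subset_of_nonneg ?_ fun _ _ _ => sq_nonneg _
  intro e he
  obtain ⟨w, -, rfl⟩ := Finset.mem_image.1 he
  exact mem_PN.2 ⟨w, d, hd, rfl⟩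

/-! ### Restriction to a cell -/

lemma Dform_comp_le {L : ℕ} {A : Finset (ℕ × ℕ)} (h : GoodCarpet L A) (n : ℕ)
    (f : ℝ × ℝ → ℝ) (p : ℕ × ℕ) (hp : p ∈ A) :
    Dform L A n (fun x => f (Psi L p x)) ≤ Dform L A (n + 1) f := by
  have hL : (L : ℝ) ≠ 0 := by have := h.three_le; positivity
  rw [Dform_eq, Dform_eq]
  gcongr
  have hPi : Function.Injective (Psi L p) := by
    intro x y hxy
    simp only [Psi, Prod.mk.injEq] at hxy
    rw [div_left_inj' hL, div_left_inj' hL] at hxy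
    exact Prod.ext (add_right_cancel hxy.1) (add_right_cancel hxy.2)
  have hi : Function.Injective fun e : (ℝ × ℝ) × (ℝ × ℝ) => (Psi L p e.1, Psi L p e.2) := by
    intro e e' he
    simp only [Prod.mk.injEq] at he
    exact Prod.ext (hPi he.1) (hPi he.2)
  have h1 : ∑ e ∈ PN L A n, (f (Psi L p e.1) - f (Psi L p e.2)) ^ 2
      = ∑ e ∈ (PN L A n).image (fun e => (Psi L p e.1, Psi L p e.2)), (f e.1 - f e.2) ^ 2 := by
    rw [Finset.sum_image fun _ _ _ _ hh => hi hh]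
  rw [h1]
  refine Finset.sum_le_sum_of_subset_of_nonneg ?_ fun _ _ _ => sq_nonneg _
  intro e he
  obtain ⟨e', he', rfl⟩ := Finset.mem_image.1 he
  obtain ⟨w, d, hd, rfl⟩ := mem_PN.1 he'
  refine mem_PN.2 ⟨Fin.cons ⟨p, hp⟩ w, d, hd, ?_⟩
  rw [PsiW_succ_left, PsiW_succ_left]
  simp

/-! ### Bilinear interpolation -/

/-- The bilinear form on the unit cell. -/
noncomputable def bil (a b c d s t : ℝ) : ℝ :=
  (1 - s) * (1 - t) * a + s * (1 - t) * b + s * t * c + (1 - s) * t * d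

/-- Bilinear interpolation of `f` from the grid of mesh `1/N`. -/
noncomputable def interp (N : ℝ) (f : ℝ × ℝ → ℝ) (x : ℝ × ℝ) : ℝ :=
  bil (f (⌊N * x.1⌋ / N, ⌊N * x.2⌋ / N)) (f ((⌊N * x.1⌋ + 1) / N, ⌊N * x.2⌋ / N))
    (f ((⌊N * x.1⌋ + 1) / N, (⌊N * x.2⌋ + 1) / N)) (f (⌊N * x.1⌋ / N, (⌊N * x.2⌋ + 1) / N))
    (Int.fract (N * x.1)) (Int.fract (N * x.2))

lemma floor_cases (i : ℕ) (s : ℝ) (h0 : 0 ≤ s) (h1 : s ≤ 1) :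
    ((⌊s + (i : ℝ)⌋ : ℝ) = i ∧ Int.fract (s + (i : ℝ)) = s) ∨
    (s = 1 ∧ (⌊s + (i : ℝ)⌋ : ℝ) = 1 + i ∧ Int.fract (s + (i : ℝ)) = 0) := by
  rcases h1.lt_or_eq with h1 | rfl
  · left
    rw [Int.floor_add_natCast, Int.fract_add_natCast, Int.floor_eq_zero_iff.2 ⟨h0, h1⟩,
      Int.fract_eq_self.2 ⟨h0, h1⟩]
    simp
  · right
    rw [Int.floor_add_natCast, Int.fract_add_natCast]
    simp

lemma interp_eq (N : ℝ) (hN : N ≠ 0) (f : ℝ × ℝ → ℝ) (i j : ℕ) (s t : ℝ)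
    (hs0 : 0 ≤ s) (hs1 : s ≤ 1) (ht0 : 0 ≤ t) (ht1 : t ≤ 1) :
    interp N f ((s + i) / N, (t + j) / N) =
      bil (f ((0 + i) / N, (0 + j) / N)) (f ((1 + i) / N, (0 + j) / N))
        (f ((1 + i) / N, (1 + j) / N)) (f ((0 + i) / N, (1 + j) / N)) s t := by
  unfold interp
  simp only [mul_div_cancel₀ _ hN]
  rcases floor_cases i s hs0 hs1 with ⟨h1, h2⟩ | ⟨h0, h1, h2⟩ <;>
  rcases floor_cases j t ht0 ht1 with ⟨h3, h4⟩ | ⟨h5, h3, h4⟩ <;>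
  rw [h1, h2, h3, h4] <;> (try subst h0) <;> (try subst h5) <;>
  simp [bil, add_comm]

lemma bil_sub_sq (a b c d s t : ℝ) (hs0 : 0 ≤ s) (hs1 : s ≤ 1) (ht0 : 0 ≤ t) (ht1 : t ≤ 1) :
    (bil a b c d s t - a) ^ 2 ≤ 3 * ((b - a) ^ 2 + (c - b) ^ 2 + (d - a) ^ 2) := by
  have e : bil a b c d s t - a = s * (b - a) + s * t * (c - b) + (1 - s) * t * (d - a) := by
    unfold bil; ring
  rw [e]
  have key : ∀ k u : ℝ, 0 ≤ k → k ≤ 1 → (k * u) ^ 2 ≤ u ^ 2 := by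
    intro k u h0 h1
    rw [mul_pow]
    have : k ^ 2 ≤ 1 := pow_le_one₀ h0 h1
    nlinarith [sq_nonneg u]
  have k1 := key s (b - a) hs0 hs1
  have k2 := key (s * t) (c - b) (by positivity) (mul_le_one₀ hs1 ht0 ht1)
  have k3 := key ((1 - s) * t) (d - a) (mul_nonneg (by linarith) ht0)
    (mul_le_one₀ (by linarith) ht0 ht1)
  generalize s * (b - a) = X at *
  generalize s * t * (c - b) = Y at *
  generalize (1 - s) * t * (d - a) = Z at *
  nlinarith [sq_nonneg (X - Y), sq_nonneg (Y - Z), sq_nonneg (X - Z)]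

lemma V0_bounds {p : ℝ × ℝ} (hp : p ∈ V0) : 0 ≤ p.1 ∧ p.1 ≤ 1 ∧ 0 ≤ p.2 ∧ p.2 ≤ 1 := by
  simp only [V0, Finset.mem_insert, Finset.mem_singleton] at hp
  rcases hp with rfl | rfl | rfl | rfl <;> norm_num

lemma three_edges_le (F : (ℝ × ℝ) → ℝ) :
    (F (1, 0) - F (0, 0)) ^ 2 + (F (1, 1) - F (1, 0)) ^ 2 + (F (0, 1) - F (0, 0)) ^ 2 ≤
      ∑ d ∈ Eg, (F d.1 - F d.2) ^ 2 := by
  have hsub : ({((1, 0), (0, 0)), ((1, 1), (1, 0)), ((0, 1), (0, 0))} :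
      Finset ((ℝ × ℝ) × (ℝ × ℝ))) ⊆ Eg := by
    intro d hd
    simp only [Finset.mem_insert, Finset.mem_singleton] at hd
    unfold Eg
    rcases hd with rfl | rfl | rfl <;> simp [V0, eudist]
  refine le_trans (le_of_eq ?_)
    (Finset.sum_le_sum_of_subset_of_nonneg hsub fun _ _ _ => sq_nonneg _)
  rw [Finset.sum_insert (by simp), Finset.sum_insert (by simp), Finset.sum_singleton]
  ring

lemma QC_interp_le {L : ℕ} {A : Finset (ℕ × ℕ)} (h : GoodCarpet L A) (n : ℕ)
    (f : ℝ × ℝ → ℝ) (w : Word A (n + 1)) :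
    QC L (interp ((L : ℝ) ^ n) f) w ≤
      (Eg.card : ℝ) * (12 * QC L f (fun i : Fin n => w i.castSucc)) := by
  obtain ⟨a, b, hinj, hab⟩ := exists_code h n
  have hL3 := h.three_le
  have hL : (0 : ℝ) < L := by positivity
  set v : Word A n := fun i : Fin n => w i.castSucc with hv
  have hval : ∀ p ∈ V0, (interp ((L : ℝ) ^ n) f (PsiW L w p) - f (PsiW L v (0, 0))) ^ 2
      ≤ 3 * QC L f v := by
    intro p hp
    obtain ⟨p1, p2, p3, p4⟩ := V0_bounds hp
    have hl := h.mem_lt _ (w (Fin.last n)).2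
    have q1 : (((w (Fin.last n)).1.1 : ℕ) : ℝ) + 1 ≤ L := by exact_mod_cast hl.1
    have q2 : (((w (Fin.last n)).1.2 : ℕ) : ℝ) + 1 ≤ L := by exact_mod_cast hl.2
    have hcell : interp ((L : ℝ) ^ n) f (PsiW L w p) =
        bil (f (PsiW L v (0, 0))) (f (PsiW L v (1, 0))) (f (PsiW L v (1, 1)))
          (f (PsiW L v (0, 1))) ((p.1 + (w (Fin.last n)).1.1) / L)
          ((p.2 + (w (Fin.last n)).1.2) / L) := by
      rw [PsiW_succ_right, ← hv]
      simp only [hab]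
      rw [interp_eq _ (by positivity)]
      · rfl
      · simp only [Psi]; positivity
      · simp only [Psi]; rw [div_le_one hL]; linarith
      · simp only [Psi]; positivity
      · simp only [Psi]; rw [div_le_one hL]; linarith
    rw [hcell]
    refine (bil_sub_sq _ _ _ _ _ _ ?_ ?_ ?_ ?_).trans ?_
    · positivity
    · rw [div_le_one hL]; linarith
    · positivity
    · rw [div_le_one hL]; linarith
    · have := three_edges_le fun x => f (PsiW L v x)
      unfold QC
      linarith
  conv_lhs => unfold QC
  rw [← nsmul_eq_mul]
  refine Finset.sum_le_card_nsmul _ _ _ fun d hd => ?_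
  unfold Eg at hd
  rw [Finset.mem_filter, Finset.mem_product] at hd
  have h1 := hval _ hd.1.1
  have h2 := hval _ hd.1.2
  generalize interp ((L : ℝ) ^ n) f (PsiW L w d.1) = X at *
  generalize interp ((L : ℝ) ^ n) f (PsiW L w d.2) = Y at *
  generalize f (PsiW L v (0, 0)) = Z at *
  nlinarith [sq_nonneg (X - Z + (Y - Z))]

lemma Dform_interp_le {L : ℕ} {A : Finset (ℕ × ℕ)} (h : GoodCarpet L A) (n : ℕ)
    (f : ℝ × ℝ → ℝ) :
    Dform L A (n + 1) (interp ((L : ℝ) ^ n) f) ≤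
      (12 * (Eg.card : ℝ) ^ 2 * A.card) * Dform L A n f := by
  have h1 := Dform_le_cells L A (n + 1) (interp ((L : ℝ) ^ n) f)
  have h2 : ∑ w : Word A (n + 1), QC L (interp ((L : ℝ) ^ n) f) w ≤
      ∑ w : Word A (n + 1), (Eg.card : ℝ) * (12 * QC L f (fun i : Fin n => w i.castSucc)) :=
    Finset.sum_le_sum fun w _ => QC_interp_le h n f w
  have h3 : ∑ w : Word A (n + 1), QC L f (fun i : Fin n => w i.castSucc) =
      (A.card : ℝ) * ∑ w : Word A n, QC L f w := by
    have := Fintype.sum_equiv (Fin.snocEquiv fun _ : Fin (n + 1) => {p : ℕ × ℕ // p ∈ A}).symm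
      (fun w : Word A (n + 1) => QC L f (fun i : Fin n => w i.castSucc))
      (fun z => QC L f z.2) (fun w => rfl)
    rw [this, Fintype.sum_prod_type]
    simp
  have h4 := cells_le_Dform h n f
  simp only [← Finset.mul_sum] at h2
  rw [h3] at h2
  have h5 : (Eg.card : ℝ) * (12 * ((A.card : ℝ) * ∑ w : Word A n, QC L f w)) ≤
      (Eg.card : ℝ) * (12 * ((A.card : ℝ) * ((Eg.card : ℝ) * (2 * Dform L A n f)))) := by
    gcongr
  nlinarith

/-! ### Comparison of conductances -/

/-- Energies of admissible functions. -/
def adm (L : ℕ) (A : Finset (ℕ × ℕ)) (n : ℕ) : Set ℝ :=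
  {e : ℝ | ∃ f : ℝ × ℝ → ℝ,
      (∀ x ∈ ({((0 : ℝ), (0 : ℝ))} : Set (ℝ × ℝ)), f x = 1) ∧
      (∀ x ∈ ({((1 : ℝ), (0 : ℝ))} : Set (ℝ × ℝ)), f x = 0) ∧ e = Dform L A n f}

lemma mem_adm {L : ℕ} {A : Finset (ℕ × ℕ)} {n : ℕ} {e : ℝ} :
    e ∈ adm L A n ↔ ∃ f : ℝ × ℝ → ℝ, f (0, 0) = 1 ∧ f (1, 0) = 0 ∧ e = Dform L A n f := by
  simp [adm]

lemma RR_eq (L : ℕ) (A : Finset (ℕ × ℕ)) (n : ℕ) : RR L A n = (sInf (adm L A n))⁻¹ := rfl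

lemma adm_nonneg {L : ℕ} {A : Finset (ℕ × ℕ)} {n : ℕ} {e : ℝ} (he : e ∈ adm L A n) : 0 ≤ e := by
  obtain ⟨f, -, -, rfl⟩ := mem_adm.1 he
  exact Dform_nonneg _ _ _ _

lemma adm_nonempty (L : ℕ) (A : Finset (ℕ × ℕ)) (n : ℕ) : (adm L A n).Nonempty :=
  ⟨_, mem_adm.2 ⟨fun x => 1 - x.1, by simp, by simp, rfl⟩⟩

lemma adm_bdd (L : ℕ) (A : Finset (ℕ × ℕ)) (n : ℕ) : BddBelow (adm L A n) :=
  ⟨0, fun _ he => adm_nonneg he⟩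

lemma conductance_le_succ {L : ℕ} {A : Finset (ℕ × ℕ)} (h : GoodCarpet L A) (n : ℕ) :
    sInf (adm L A n) ≤ (L : ℝ) ^ 2 * sInf (adm L A (n + 1)) := by
  have hL3 := h.three_le
  have hL : (0 : ℝ) < L := by positivity
  rw [← div_le_iff₀' (by positivity)]
  refine le_csInf (adm_nonempty _ _ _) fun e he => ?_
  obtain ⟨f, hf0, hf1, rfl⟩ := mem_adm.1 he
  rw [div_le_iff₀' (by positivity)]
  have hex : ∃ i ∈ Finset.range L,
      1 / (L : ℝ) ≤ f ((i : ℝ) / L, 0) - f (((i + 1 : ℕ) : ℝ) / L, 0) := by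
    refine Finset.exists_le_of_sum_le ⟨0, by simp; omega⟩ ?_
    rw [Finset.sum_range_sub' (fun i : ℕ => f ((i : ℝ) / L, 0))]
    simp [hL.ne', hf0, hf1]
  obtain ⟨i, hi, hd⟩ := hex
  set δ := f ((i : ℝ) / L, 0) - f (((i + 1 : ℕ) : ℝ) / L, 0) with hδ
  have hδ0 : 0 < δ := lt_of_lt_of_le (by positivity) hd
  have hiA : (i, 0) ∈ A := h.flat_border i 0 (Finset.mem_range.1 hi) (by omega) (by simp)
  have hmem : δ⁻¹ ^ 2 * Dform L A n (fun x => f (Psi L (i, 0) x)) ∈ adm L A n := by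
    refine mem_adm.2
      ⟨fun x => δ⁻¹ * (f (Psi L (i, 0) x) - f (((i + 1 : ℕ) : ℝ) / L, 0)), ?_, ?_, ?_⟩
    · have : f (Psi L (i, 0) (0, 0)) = f ((i : ℝ) / L, 0) := by simp [Psi]
      simp only [this, ← hδ]
      exact inv_mul_cancel₀ hδ0.ne'
    · have : f (Psi L (i, 0) (1, 0)) = f (((i + 1 : ℕ) : ℝ) / L, 0) := by
        simp [Psi, add_comm]
      simp only [this]
      simp
    · rw [Dform_eq, Dform_eq, mul_left_comm, Finset.mul_sum]
      congr 1
      refine Finset.sum_congr rfl fun e _ => ?_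
      ring
  have hDn := Dform_nonneg L A n (fun x => f (Psi L (i, 0) x))
  calc sInf (adm L A n) ≤ δ⁻¹ ^ 2 * Dform L A n (fun x => f (Psi L (i, 0) x)) :=
        csInf_le (adm_bdd _ _ _) hmem
    _ ≤ (L : ℝ) ^ 2 * Dform L A (n + 1) f := by
        have h1 : δ⁻¹ ≤ L := by
          rw [inv_le_comm₀ hδ0 hL]
          simpa using hd
        have h2 := Dform_comp_le h n f (i, 0) hiA
        gcongr

lemma conductance_succ_le {L : ℕ} {A : Finset (ℕ × ℕ)} (h : GoodCarpet L A) (n : ℕ) :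
    sInf (adm L A (n + 1)) ≤ (12 * (Eg.card : ℝ) ^ 2 * A.card + 1) * sInf (adm L A n) := by
  have hL3 := h.three_le
  have hL : (0 : ℝ) < L := by positivity
  rw [← div_le_iff₀' (by positivity)]
  refine le_csInf (adm_nonempty _ _ _) fun e he => ?_
  obtain ⟨f, hf0, hf1, rfl⟩ := mem_adm.1 he
  rw [div_le_iff₀' (by positivity)]
  have hN : (L : ℝ) ^ n ≠ 0 := by positivity
  have hk : (((L ^ n : ℕ) : ℝ)) = (L : ℝ) ^ n := by push_cast; rfl
  have hmem : Dform L A (n + 1) (interp ((L : ℝ) ^ n) f) ∈ adm L A (n + 1) := by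
    refine mem_adm.2 ⟨_, ?_, ?_, rfl⟩
    · have := interp_eq _ hN f 0 0 0 0 le_rfl zero_le_one le_rfl zero_le_one
      simpa [bil, hf0] using this
    · have := interp_eq _ hN f (L ^ n) 0 0 0 le_rfl zero_le_one le_rfl zero_le_one
      simpa [bil, hf1, hN, hL.ne'] using this
  have := csInf_le (adm_bdd _ _ _) hmem
  have h2 := Dform_interp_le h n f
  have h3 := Dform_nonneg L A n f
  linarith

lemma inv_le_of_le {x y c : ℝ} (hx : 0 ≤ x) (hy : 0 ≤ y) (hc : 0 < c) (hxy0 : x = 0 → y = 0)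
    (hxy : x ≤ c * y) : y⁻¹ ≤ c * x⁻¹ := by
  rcases hx.eq_or_lt with hx' | hx'
  · rw [hxy0 hx'.symm, ← hx']
    simp
  · have hy' : 0 < y := by
      by_contra hcon
      have : y = 0 := le_antisymm (not_lt.1 hcon) hy
      rw [this, mul_zero] at hxy
      linarith
    rw [← div_eq_mul_inv, le_div_iff₀ hx', inv_mul_le_iff₀ hy', mul_comm]
    exact hxy

/-- equation (3.12), planar case: two-sided doubling property of the
resistance sequence. -/
theorem two_sided_doubling (L : ℕ) (A : Finset (ℕ × ℕ)) (h : GoodCarpet L A) :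
    ∃ c : ℝ, 1 ≤ c ∧ ∀ n : ℕ,
      c⁻¹ * RR L A n ≤ RR L A (n + 1) ∧ RR L A (n + 1) ≤ c * RR L A n := by
  obtain ⟨K, hK⟩ : ∃ K : ℝ, K = 12 * (Eg.card : ℝ) ^ 2 * A.card + 1 := ⟨_, rfl⟩
  have hK1 : 1 ≤ K := by
    rw [hK]
    have : (0 : ℝ) ≤ 12 * (Eg.card : ℝ) ^ 2 * A.card := by positivity
    linarith
  have hc : 0 < K + (L : ℝ) ^ 2 := by positivity
  refine ⟨K + (L : ℝ) ^ 2, by nlinarith [sq_nonneg (L : ℝ)], fun n => ?_⟩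
  have h1 := conductance_le_succ h n
  have h2 := conductance_succ_le h n
  rw [← hK] at h2
  rw [RR_eq, RR_eq]
  have hx : 0 ≤ sInf (adm L A n) := Real.sInf_nonneg fun _ he => adm_nonneg he
  have hy : 0 ≤ sInf (adm L A (n + 1)) := Real.sInf_nonneg fun _ he => adm_nonneg he
  generalize sInf (adm L A n) = x at *
  generalize sInf (adm L A (n + 1)) = y at *
  have e1 : x = 0 → y = 0 := by
    rintro rfl
    rw [mul_zero] at h2
    exact le_antisymm h2 hy
  have e2 : y = 0 → x = 0 := by
    rintro rfl
    rw [mul_zero] at h1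
    exact le_antisymm h1 hx
  constructor
  · rw [inv_mul_le_iff₀ hc]
    exact inv_le_of_le hy hx hc e2 (by nlinarith [sq_nonneg (L : ℝ)])
  · exact inv_le_of_le hx hy hc e1 (by nlinarith [sq_nonneg (L : ℝ)])


end Carpet
end
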